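/- arXiv:1709.05389 — 2 statements merged into one kernel-verified Lean document; each statement's English description precedes it below -/
import Mathlib

section
/- For every integer s ≥ 2, the Riemann zeta function satisfies ζ(s) = 1/2 + 1/(s−1) + (2(−1)^{s−1}/(s−1)!) ∫₀^∞ (x^s/(1+x²)) · g^{(s−1)}(x) dx, and also ζ(s) = 1/2 + 1/(s−1) + (2/(s−1)!) ∫₀^∞ g(x) · h_s^{(s−1)}(x) dx, where h_s(x) = x^s/(1+x²). -/
open Real MeasureTheory Set

/-- `g x = 1/(e^{2πx} - 1)`. -/
noncomputable def g (x : ℝ) : ℝ := 1 / (Real.exp (2 * π * x) - 1)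

/-- `h_s(x) = x^s/(1+x²)`. -/
noncomputable def h (s : ℕ) (x : ℝ) : ℝ := x ^ s / (1 + x ^ 2)

open Filter Topology

/-- Powers times a decaying exponential are integrable on the half-line. -/
lemma integrableOn_pow_mul_exp_neg_mul (m : ℕ) {a : ℝ} (ha : 0 < a) :
    IntegrableOn (fun t : ℝ => t ^ m * Real.exp (-(a * t))) (Ioi 0) := by
  have := integrableOn_rpow_mul_exp_neg_mul_rpow (p := 1) (s := m) (b := a)
    (by linarith [(Nat.cast_nonneg m : (0 : ℝ) ≤ m)]) one_pos ha
  simpa [Real.rpow_natCast] using this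

lemma norm_pow_mul_cexp_neg_mul (m : ℕ) (z : ℂ) {t : ℝ} (ht : 0 ≤ t) :
    ‖(t : ℂ) ^ m * Complex.exp (-(z * t))‖ = t ^ m * Real.exp (-(z.re * t)) := by
  simp [Complex.norm_exp, abs_of_nonneg ht]

lemma integrableOn_pow_mul_cexp_neg_mul (m : ℕ) {z : ℂ} (hz : 0 < z.re) :
    IntegrableOn (fun t : ℝ => (t : ℂ) ^ m * Complex.exp (-(z * t))) (Ioi 0) := by
  refine (integrableOn_pow_mul_exp_neg_mul m hz).mono' ?_ ?_
  · exact Continuous.aestronglyMeasurable (by fun_prop)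
  · filter_upwards [ae_restrict_mem measurableSet_Ioi] with t ht
    exact (norm_pow_mul_cexp_neg_mul m z (le_of_lt ht)).le

lemma integral_pow_mul_cexp_neg_mul (m : ℕ) {z : ℂ} (hz : 0 < z.re) :
    ∫ t : ℝ in Ioi 0, (t : ℂ) ^ m * Complex.exp (-(z * t)) = m.factorial / z ^ (m + 1) := by
  have hz0 : z ≠ 0 := by rintro rfl; simp at hz
  have hexp (t : ℝ) : HasDerivAt (fun t : ℝ => Complex.exp (-(z * t)))
      (-z * Complex.exp (-(z * t))) t := by
    have := (((hasDerivAt_id (t : ℂ)).const_mul z).neg.cexp).comp_ofReal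
    convert! this using 1
    simp; ring
  have hlim (m : ℕ) :
      Tendsto (fun t : ℝ => (t : ℂ) ^ m * Complex.exp (-(z * t))) atTop (𝓝 0) := by
    rw [tendsto_zero_iff_norm_tendsto_zero]
    have := tendsto_rpow_mul_exp_neg_mul_atTop_nhds_zero m z.re hz
    refine this.congr' ?_
    filter_upwards [eventually_ge_atTop 0] with t ht
    rw [norm_pow_mul_cexp_neg_mul m z ht, Real.rpow_natCast]; simp
  induction m with
  | zero =>
    have h1 := integral_Ioi_of_hasDerivAt_of_tendsto
      (f := fun t : ℝ => (-1 / z) * Complex.exp (-(z * t))) (a := 0) (m := 0)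
      (f' := fun t : ℝ => (t : ℂ) ^ 0 * Complex.exp (-(z * t)))
      (by fun_prop)
      (fun t _ => by
        convert! (hexp t).const_mul (-1 / z) using 1
        field_simp)
      (integrableOn_pow_mul_cexp_neg_mul 0 hz)
      (by simpa using (hlim 0).const_mul (-1 / z))
    rw [h1]; simp [neg_div]
  | succ m ih =>
    have hi := integrableOn_pow_mul_cexp_neg_mul m hz
    have hi' := integrableOn_pow_mul_cexp_neg_mul (m + 1) hz
    have h1 := integral_Ioi_of_hasDerivAt_of_tendsto
      (f := fun t : ℝ => (t : ℂ) ^ (m + 1) * Complex.exp (-(z * t))) (a := 0) (m := 0)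
      (f' := fun t : ℝ => (m + 1) * ((t : ℂ) ^ m * Complex.exp (-(z * t)))
        - z * ((t : ℂ) ^ (m + 1) * Complex.exp (-(z * t))))
      (by fun_prop)
      (fun t _ => by
        have hp : HasDerivAt (fun t : ℝ => (t : ℂ) ^ (m + 1)) ((m + 1) * (t : ℂ) ^ m) t := by
          simpa using (hasDerivAt_pow (m + 1) (t : ℂ)).comp_ofReal
        convert! hp.mul (hexp t) using 1
        ring)
      ((hi.const_mul _).sub (hi'.const_mul _))
      (hlim (m + 1))
    rw [integral_sub (hi.const_mul _) (hi'.const_mul _), integral_const_mul, integral_const_mul,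
      ih] at h1
    simp only [Complex.ofReal_zero, ne_eq, Nat.add_eq_zero_iff, one_ne_zero, and_false,
      not_false_eq_true, zero_pow, zero_mul, sub_zero] at h1
    rw [eq_div_iff (by positivity), pow_succ z (m + 1), Nat.factorial_succ]
    push_cast
    field_simp at h1
    linear_combination -h1

lemma integral_pow_mul_exp_neg_mul (m : ℕ) {a : ℝ} (ha : 0 < a) :
    ∫ t : ℝ in Ioi 0, t ^ m * Real.exp (-(a * t)) = m.factorial / a ^ (m + 1) := by
  have := integral_pow_mul_cexp_neg_mul m (z := a) (by simpa using ha)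
  rw [← Complex.ofReal_inj, ← integral_complex_ofReal]
  push_cast
  exact this

lemma integral_pow_mul_exp_neg_mul_mul_sin (m : ℕ) {a : ℝ} (ha : 0 < a) (x : ℝ) :
    ∫ t : ℝ in Ioi 0, t ^ m * Real.exp (-(a * t)) * Real.sin (x * t) =
      (m.factorial / (a - x * Complex.I) ^ (m + 1) : ℂ).im := by
  have hre : 0 < (a - x * Complex.I : ℂ).re := by simpa using ha
  rw [← integral_pow_mul_cexp_neg_mul m hre]
  have h := integral_im (𝕜 := ℂ) (integrableOn_pow_mul_cexp_neg_mul m hre)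
  simp only [RCLike.im_to_complex] at h
  rw [← h]
  congr 1 with t
  rw [← Complex.ofReal_pow, Complex.im_ofReal_mul, Complex.exp_im]
  simp [mul_assoc]

lemma integral_exp_neg_mul_mul_sin {a : ℝ} (ha : 0 < a) (x : ℝ) :
    ∫ t : ℝ in Ioi 0, Real.exp (-(a * t)) * Real.sin (x * t) = x / (x ^ 2 + a ^ 2) := by
  have := integral_pow_mul_exp_neg_mul_mul_sin 0 ha x
  simp only [pow_zero, one_mul, zero_add, pow_one] at this
  rw [this]
  simp [Complex.normSq_apply]
  ring

/-- Partial fraction decomposition of `h s`, with `1/(1 - ix)` carrying the pole part. -/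
lemma exists_h_eq_eval_add_im (s : ℕ) : ∃ P : Polynomial ℝ,
    (Polynomial.derivative^[s - 1] P = 0) ∧ ∀ x : ℝ, h s x =
      P.eval x + (Complex.I * (-Complex.I) ^ s / (1 - x * Complex.I) : ℂ).im := by
  induction s using Nat.twoStepInduction with
  | zero =>
    refine ⟨0, by simp, fun x => ?_⟩
    simp [h, Complex.div_im, Complex.normSq_apply]
    ring
  | one =>
    refine ⟨0, by simp, fun x => ?_⟩
    simp [h, Complex.normSq_apply]
    ring
  | more s ih _ =>
    obtain ⟨P, hP, hx⟩ := ih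
    refine ⟨Polynomial.X ^ s - P, ?_, fun x => ?_⟩
    · rw [Polynomial.iterate_derivative_sub, Polynomial.iterate_derivative_eq_zero (by simp)]
      rcases s with _ | s
      · simp_all
      · rw [show s + 1 + 2 - 1 = 2 + (s + 1 - 1) by omega, Function.iterate_add_apply, hP]
        simp
    · have h1 : (Complex.I * (-Complex.I) ^ (s + 2) / (1 - x * Complex.I) : ℂ) =
          -(Complex.I * (-Complex.I) ^ s / (1 - x * Complex.I)) := by
        rw [pow_add]; simp; ring
      have h2 : h (s + 2) x = x ^ s - h s x := by
        have : 1 + x ^ 2 ≠ 0 := by positivity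
        simp only [h]; field_simp; ring
      rw [h1, h2, hx]
      simp
      ring

lemma iteratedDeriv_h_eq_integral (m : ℕ) (x : ℝ) :
    iteratedDeriv m (h (m + 1)) x =
      ∫ t : ℝ in Ioi 0, t ^ m * Real.exp (-t) * Real.sin (x * t) := by
  obtain ⟨P, hP, hx⟩ := exists_h_eq_eval_add_im (m + 1)
  have key (k : ℕ) : iteratedDeriv k (h (m + 1)) = fun x : ℝ =>
      (Polynomial.derivative^[k] P).eval x +
        (Complex.I * (-Complex.I) ^ (m + 1) * (Complex.I ^ k * k.factorial) /
          (1 - x * Complex.I) ^ (k + 1) : ℂ).im := by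
    induction k with
    | zero => ext x; simp [hx]
    | succ k ih =>
      ext x
      rw [iteratedDeriv_succ, ih]
      have hne : (1 - x * Complex.I : ℂ) ≠ 0 := fun h0 => by
        simpa using congrArg Complex.re h0
      have hlin : HasDerivAt (fun x : ℝ => (1 - x * Complex.I : ℂ)) (-Complex.I) x := by
        simpa using (((hasDerivAt_id (x : ℂ)).mul_const Complex.I).const_sub 1).comp_ofReal
      have hc := ((hlin.fun_pow (k + 1)).inv (pow_ne_zero _ hne)).const_mul
        (Complex.I * (-Complex.I) ^ (m + 1) * (Complex.I ^ k * k.factorial))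
      have him := Complex.imCLM.hasFDerivAt.comp_hasDerivAt x hc
      have := ((Polynomial.derivative^[k] P).hasDerivAt x).add him
      rw [Function.iterate_succ_apply']
      convert! this.deriv using 1
      congr 1
      rw [Complex.imCLM_apply]
      congr 1
      rw [Nat.factorial_succ]
      push_cast
      rw [← mul_div_assoc, div_eq_div_iff (pow_ne_zero _ hne) (pow_ne_zero _ (pow_ne_zero _ hne))]
      ring
  rw [key m, Nat.add_sub_cancel] at *
  have := integral_pow_mul_exp_neg_mul_mul_sin m one_pos x
  simp only [one_mul] at this
  rw [this]
  simp only [hP, Polynomial.eval_zero, zero_add]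
  congr 1
  have : Complex.I * (-Complex.I) ^ (m + 1) * Complex.I ^ m = 1 := by
    rw [pow_succ, show Complex.I * ((-Complex.I) ^ m * -Complex.I) * Complex.I ^ m =
      (-Complex.I * Complex.I) ^ m * (-Complex.I * Complex.I) by rw [mul_pow]; ring]
    simp
  rw [← mul_assoc, this]
  simp

/-- The exponents `2π(n+1)` in the expansion of `g` into decaying exponentials. -/
noncomputable def gRate (n : ℕ) : ℝ := 2 * π * (n + 1)

lemma gRate_pos (n : ℕ) : 0 < gRate n := by unfold gRate; positivity

lemma summable_one_div_gRate_sq : Summable fun n : ℕ => 1 / gRate n ^ 2 := by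
  have := (summable_nat_add_iff 1).2 (Real.summable_one_div_nat_pow.2 one_lt_two)
  refine (this.mul_left (1 / (2 * π) ^ 2)).congr fun n => ?_
  simp only [gRate]
  push_cast
  field_simp

lemma hasSum_exp_neg_gRate {x : ℝ} (hx : 0 < x) :
    HasSum (fun n : ℕ => Real.exp (-(gRate n * x))) (g x) := by
  have hlt : Real.exp (-(2 * π * x)) < 1 := by
    rw [Real.exp_lt_one_iff]; simp; positivity
  convert! (hasSum_geometric_of_lt_one (Real.exp_pos _).le hlt).mul_left
    (Real.exp (-(2 * π * x))) using 1
  · ext n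
    rw [← Real.exp_nat_mul, ← Real.exp_add]
    simp only [gRate]; ring_nf
  · have : Real.exp (2 * π * x) - 1 ≠ 0 := by
      have := Real.add_one_lt_exp (x := 2 * π * x) (by positivity)
      have : 0 < 2 * π * x := by positivity
      linarith
    rw [g, Real.exp_neg]
    have h2 := Real.exp_pos (2 * π * x)
    field_simp

lemma summable_gRate_pow_mul_exp_neg (k : ℕ) {x : ℝ} (hx : 0 < x) :
    Summable fun n : ℕ => gRate n ^ k * Real.exp (-(gRate n * x)) := by
  have := (summable_nat_add_iff 1).2
    (Real.summable_pow_mul_exp_neg_nat_mul k (r := 2 * π * x) (by positivity))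
  refine (this.mul_left ((2 * π) ^ k)).congr fun n => ?_
  simp only [gRate, mul_pow]
  push_cast
  ring_nf

lemma hasSum_iteratedDeriv_g (k : ℕ) {x : ℝ} (hx : 0 < x) :
    HasSum (fun n : ℕ => (-gRate n) ^ k * Real.exp (-(gRate n * x))) (iteratedDeriv k g x) := by
  have hsum (k : ℕ) {x : ℝ} (hx : 0 < x) :
      Summable fun n : ℕ => (-gRate n) ^ k * Real.exp (-(gRate n * x)) := by
    refine Summable.of_norm ((summable_gRate_pow_mul_exp_neg k hx).congr fun n => ?_)
    simp [abs_of_pos (gRate_pos n)]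
  induction k generalizing x with
  | zero => simpa using hasSum_exp_neg_gRate hx
  | succ k ih =>
    have hd := hasDerivAt_tsum_of_isPreconnected (t := Ioi (x / 2)) (y₀ := x) (y := x)
      (g := fun n y => (-gRate n) ^ k * Real.exp (-(gRate n * y)))
      (g' := fun n y => (-gRate n) ^ (k + 1) * Real.exp (-(gRate n * y)))
      (summable_gRate_pow_mul_exp_neg (k + 1) (half_pos hx)) isOpen_Ioi isPreconnected_Ioi
      (fun n y _ => by
        convert! (((hasDerivAt_id y).const_mul (gRate n)).neg.exp).const_mul
          ((-gRate n) ^ k) using 1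
        simp; ring)
      (fun n y hy => by
        rw [norm_mul, norm_pow, norm_neg, Real.norm_of_nonneg (gRate_pos n).le,
          Real.norm_of_nonneg (Real.exp_pos _).le]
        have := gRate_pos n
        have hy : x / 2 < y := hy
        gcongr)
      (half_lt_self hx) (hsum k hx) (half_lt_self hx)
    have heq : iteratedDeriv k g =ᶠ[𝓝 x]
        fun y => ∑' n : ℕ, (-gRate n) ^ k * Real.exp (-(gRate n * y)) := by
      filter_upwards [lt_mem_nhds hx] with y hy using (ih hy).tsum_eq.symm
    rw [iteratedDeriv_succ, heq.deriv_eq, hd.deriv]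
    exact (hsum (k + 1) hx).hasSum

/-- Partial fraction expansion of the hyperbolic cotangent on the positive half-line. -/
lemma hasSum_two_mul_div_add_gRate_sq {t : ℝ} (ht : 0 < t) :
    HasSum (fun n : ℕ => 2 * (t / (t ^ 2 + gRate n ^ 2)))
      (1 / (Real.exp t - 1) - 1 / t + 1 / 2) := by
  set z : ℂ := t / (2 * π) * Complex.I with hz
  have hπ : (π : ℂ) ≠ 0 := by exact_mod_cast Real.pi_ne_zero
  have ht0 : (t : ℂ) ≠ 0 := by exact_mod_cast ht.ne'
  have hzi : z ∈ Complex.integerComplement := by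
    rintro ⟨n, hn⟩
    have := congrArg Complex.im hn
    rw [hz, show (t / (2 * π) : ℂ) = ((t / (2 * π) : ℝ) : ℂ) by push_cast; rfl,
      Complex.im_ofReal_mul, Complex.intCast_im] at this
    simp at this
    have h0 : 0 < t / (2 * π) := by positivity
    exact h0.ne this
  have hs : HasSum (fun n => cotTerm z n) (π * Complex.cot (π * z) - 1 / z) := by
    rw [cot_series_rep' hzi]; exact (summable_cotTerm hzi).hasSum
  rw [← Complex.hasSum_ofReal]
  convert! hs.mul_left (Complex.I / (2 * π)) using 1
  · ext n
    have h1 : z ^ 2 - (n + 1) ^ 2 = -((t ^ 2 + gRate n ^ 2 : ℝ) : ℂ) / (2 * π) ^ 2 := by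
      simp only [hz, mul_pow, Complex.I_sq, gRate]
      push_cast
      field_simp
      ring
    have h0 : ((t ^ 2 + gRate n ^ 2 : ℝ) : ℂ) ≠ 0 := by
      rw [Complex.ofReal_ne_zero]; positivity
    have h2 : z ^ 2 - (n + 1) ^ 2 ≠ 0 := by
      rw [h1]; exact div_ne_zero (neg_ne_zero.2 h0) (by simp [hπ])
    have h3 : z - (n + 1) ≠ 0 := fun h0 => h2 (by linear_combination (z + (n + 1)) * h0)
    have h4 : z + (n + 1) ≠ 0 := fun h0 => h2 (by linear_combination (z - (n + 1)) * h0)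
    have h5 : cotTerm z n = 2 * z / (z ^ 2 - (n + 1) ^ 2) := by
      rw [cotTerm]; field_simp; ring
    rw [h5, h1]
    rw [Complex.ofReal_mul, Complex.ofReal_div, hz]
    field_simp
    simp
  · have he : Real.exp t - 1 ≠ 0 := by
      have := Real.add_one_lt_exp ht.ne'
      linarith
    have he' : Complex.exp t - 1 ≠ 0 := by exact_mod_cast he
    have he0 := Complex.exp_ne_zero t
    rw [Complex.cot_eq_exp_ratio, show 2 * Complex.I * (π * z) = -t by
      rw [hz]; field_simp; simp, Complex.exp_neg]
    have he2 : 1 - (Complex.exp t)⁻¹ ≠ 0 := by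
      intro h0; apply he'; field_simp at h0; simpa using h0
    push_cast
    rw [hz]
    field_simp
    ring

lemma hasSum_integral_Ioi {F : ℕ → ℝ → ℝ} {f : ℝ → ℝ} {u : ℕ → ℝ}
    (hF : ∀ n, IntegrableOn (F n) (Ioi 0)) (hu : Summable u)
    (hFu : ∀ n, ∫ x in Ioi 0, ‖F n x‖ ≤ u n)
    (hf : ∀ x, 0 < x → HasSum (fun n => F n x) (f x)) :
    HasSum (fun n => ∫ x in Ioi 0, F n x) (∫ x in Ioi 0, f x) := by
  have hs : Summable fun n => ∫ x in Ioi 0, ‖F n x‖ :=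
    hu.of_nonneg_of_le (fun n => integral_nonneg fun x => norm_nonneg _) hFu
  rw [← setIntegral_congr_fun measurableSet_Ioi fun x hx => (hf x hx).tsum_eq]
  exact hasSum_integral_of_summable_integral_norm hF hs

/-- The common value of the `n`-th terms of both series of integrals. -/
noncomputable def gRateIntegral (m n : ℕ) : ℝ :=
  ∫ t : ℝ in Ioi 0, t ^ m * Real.exp (-t) * (t / (t ^ 2 + gRate n ^ 2))

lemma norm_gRate_integrand_le (m n : ℕ) {t : ℝ} (ht : 0 < t) :
    ‖t ^ m * Real.exp (-t) * (t / (t ^ 2 + gRate n ^ 2))‖ ≤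
      t ^ (m + 1) * Real.exp (-(1 * t)) * (1 / gRate n ^ 2) := by
  have := gRate_pos n
  rw [Real.norm_of_nonneg (by positivity), one_mul,
    show t ^ (m + 1) * Real.exp (-t) * (1 / gRate n ^ 2) =
      t ^ m * Real.exp (-t) * (t / gRate n ^ 2) by ring]
  gcongr
  nlinarith

lemma integrableOn_gRate_integrand (m n : ℕ) :
    IntegrableOn (fun t : ℝ => t ^ m * Real.exp (-t) * (t / (t ^ 2 + gRate n ^ 2))) (Ioi 0) := by
  refine ((integrableOn_pow_mul_exp_neg_mul (m + 1) one_pos).mul_const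
    (1 / gRate n ^ 2)).mono' ?_ ?_
  · exact Measurable.aestronglyMeasurable (by fun_prop)
  · filter_upwards [ae_restrict_mem measurableSet_Ioi] with t ht
    exact norm_gRate_integrand_le m n ht

lemma integral_norm_gRate_integrand_le (m n : ℕ) :
    ∫ t in Ioi 0, ‖t ^ m * Real.exp (-t) * (t / (t ^ 2 + gRate n ^ 2))‖ ≤
      (m + 1).factorial * (1 / gRate n ^ 2) := by
  refine (setIntegral_mono_on (integrableOn_gRate_integrand m n).norm
    ((integrableOn_pow_mul_exp_neg_mul (m + 1) one_pos).mul_const _) measurableSet_Ioi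
    fun t ht => norm_gRate_integrand_le m n ht).trans_eq ?_
  rw [integral_mul_const, integral_pow_mul_exp_neg_mul _ one_pos]
  simp

lemma integral_h_mul_pow_mul_exp_neg (m n : ℕ) :
    ∫ x in Ioi (0 : ℝ), h (m + 1) x * (gRate n ^ m * Real.exp (-(gRate n * x))) =
      gRateIntegral m n := by
  have ha := gRate_pos n
  have := integral_comp_mul_left_Ioi
    (fun t : ℝ => t ^ m * Real.exp (-t) * (t / (t ^ 2 + gRate n ^ 2))) 0 ha
  rw [mul_zero, smul_eq_mul, eq_inv_mul_iff_mul_eq₀ ha.ne', ← integral_const_mul] at this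
  rw [gRateIntegral, ← this]
  congr 1 with x
  have : 1 + x ^ 2 ≠ 0 := by positivity
  rw [show (gRate n * x) ^ 2 + gRate n ^ 2 = gRate n ^ 2 * (1 + x ^ 2) by ring, h, mul_pow]
  field_simp
  ring

lemma integral_exp_neg_mul_iteratedDeriv_h (m n : ℕ) :
    ∫ x in Ioi (0 : ℝ), Real.exp (-(gRate n * x)) * iteratedDeriv m (h (m + 1)) x =
      gRateIntegral m n := by
  have ha := gRate_pos n
  simp_rw [iteratedDeriv_h_eq_integral, ← integral_const_mul]
  rw [integral_integral_swap]
  · rw [gRateIntegral]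
    congr 1 with t
    rw [← integral_exp_neg_mul_mul_sin ha, ← integral_const_mul]
    congr 1 with x
    rw [mul_comm t x]
    ring
  · have h1 := (integrableOn_pow_mul_exp_neg_mul 0 ha).mul_prod
      (integrableOn_pow_mul_exp_neg_mul m one_pos)
    refine h1.mono' (Continuous.aestronglyMeasurable (by fun_prop)) ?_
    rw [Measure.prod_restrict]
    filter_upwards [ae_restrict_mem (measurableSet_Ioi.prod measurableSet_Ioi)] with p hp
    have h2 : 0 < p.2 := hp.2
    simp only [Function.uncurry, norm_mul, norm_pow, Real.norm_eq_abs, Real.abs_exp,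
      abs_of_pos h2, pow_zero, one_mul]
    refine mul_le_mul_of_nonneg_left ?_ (Real.exp_pos _).le
    exact mul_le_of_le_one_right (by positivity) (Real.abs_sin_le_one _)

lemma norm_iteratedDeriv_h_le (m : ℕ) {x : ℝ} (hx : 0 < x) :
    ‖iteratedDeriv m (h (m + 1)) x‖ ≤ (m + 1).factorial * x := by
  rw [iteratedDeriv_h_eq_integral]
  have hint := (integrableOn_pow_mul_exp_neg_mul (m + 1) one_pos).mul_const x
  refine (norm_integral_le_of_norm_le hint ?_).trans_eq ?_
  · filter_upwards [ae_restrict_mem measurableSet_Ioi] with t ht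
    have ht : 0 < t := ht
    rw [norm_mul, Real.norm_of_nonneg (by positivity), pow_succ, one_mul,
      show t ^ m * t * Real.exp (-t) * x = t ^ m * Real.exp (-t) * (x * t) by ring]
    gcongr
    exact (Real.abs_sin_le_abs).trans_eq (abs_of_pos (by positivity))
  · rw [integral_mul_const, integral_pow_mul_exp_neg_mul _ one_pos]
    simp

lemma continuous_iteratedDeriv_h (m s : ℕ) : Continuous (iteratedDeriv m (h s)) := by
  have hc : ContDiff ℝ m (h s) := by
    unfold h
    exact ContDiff.div (by fun_prop) (by fun_prop) fun x => by positivity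
  exact hc.continuous_iteratedDeriv m le_rfl

lemma hasSum_gRateIntegral_integral_g_mul (m : ℕ) :
    HasSum (gRateIntegral m) (∫ x in Ioi (0 : ℝ), g x * iteratedDeriv m (h (m + 1)) x) := by
  have hle (n : ℕ) {x : ℝ} (hx : 0 < x) :
      ‖Real.exp (-(gRate n * x)) * iteratedDeriv m (h (m + 1)) x‖ ≤
        (m + 1).factorial * (x ^ 1 * Real.exp (-(gRate n * x))) := by
    rw [norm_mul, Real.norm_of_nonneg (Real.exp_pos _).le]
    have := mul_le_mul_of_nonneg_left (norm_iteratedDeriv_h_le m hx)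
      (Real.exp_pos (-(gRate n * x))).le
    linarith
  have hdom (n : ℕ) :=
    (integrableOn_pow_mul_exp_neg_mul 1 (gRate_pos n)).const_mul ((m + 1).factorial : ℝ)
  have hF (n : ℕ) : IntegrableOn
      (fun x => Real.exp (-(gRate n * x)) * iteratedDeriv m (h (m + 1)) x) (Ioi 0) := by
    refine (hdom n).mono' ?_ ?_
    · exact ((by fun_prop : Continuous fun x => Real.exp (-(gRate n * x))).mul
        (continuous_iteratedDeriv_h m (m + 1))).aestronglyMeasurable
    · filter_upwards [ae_restrict_mem measurableSet_Ioi] with x hx using hle n hx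
  convert! hasSum_integral_Ioi hF
    (summable_one_div_gRate_sq.mul_left ((m + 1).factorial : ℝ)) (fun n => ?_)
    (fun x hx => (hasSum_exp_neg_gRate hx).mul_right _) using 1
  · ext n; exact (integral_exp_neg_mul_iteratedDeriv_h m n).symm
  · refine (setIntegral_mono_on (hF n).norm (hdom n) measurableSet_Ioi
      fun x hx => hle n hx).trans_eq ?_
    rw [integral_const_mul, integral_pow_mul_exp_neg_mul _ (gRate_pos n)]
    simp

lemma hasSum_gRateIntegral_integral_h_mul (m : ℕ) :
    HasSum (fun n => (-1) ^ m * gRateIntegral m n)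
      (∫ x in Ioi (0 : ℝ), h (m + 1) x * iteratedDeriv m g x) := by
  have hle (n : ℕ) {x : ℝ} (hx : 0 < x) :
      ‖h (m + 1) x * ((-gRate n) ^ m * Real.exp (-(gRate n * x)))‖ ≤
        gRate n ^ m * (x ^ (m + 1) * Real.exp (-(gRate n * x))) := by
    have := gRate_pos n
    simp only [norm_mul, norm_pow, norm_neg, Real.norm_eq_abs, Real.abs_exp, abs_of_pos this]
    have h1 : |h (m + 1) x| ≤ x ^ (m + 1) := by
      rw [h, abs_of_pos (by positivity)]
      exact div_le_self (by positivity) (by nlinarith)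
    calc _ ≤ x ^ (m + 1) * (gRate n ^ m * Real.exp (-(gRate n * x))) := by gcongr
      _ = _ := by ring
  have hdom (n : ℕ) :=
    (integrableOn_pow_mul_exp_neg_mul (m + 1) (gRate_pos n)).const_mul (gRate n ^ m)
  have hF (n : ℕ) : IntegrableOn
      (fun x => h (m + 1) x * ((-gRate n) ^ m * Real.exp (-(gRate n * x)))) (Ioi 0) := by
    refine (hdom n).mono' ?_ ?_
    · refine Measurable.aestronglyMeasurable ?_
      unfold h
      fun_prop
    · filter_upwards [ae_restrict_mem measurableSet_Ioi] with x hx using hle n hx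
  convert! hasSum_integral_Ioi hF
    (summable_one_div_gRate_sq.mul_left ((m + 1).factorial : ℝ)) (fun n => ?_)
    (fun x hx => (hasSum_iteratedDeriv_g m hx).mul_left _) using 1
  · ext n
    rw [← integral_h_mul_pow_mul_exp_neg, ← integral_const_mul]
    congr 1 with x
    rw [neg_pow (gRate n)]
    ring
  · refine (setIntegral_mono_on (hF n).norm (hdom n) measurableSet_Ioi
      fun x hx => hle n hx).trans_eq ?_
    rw [integral_const_mul, integral_pow_mul_exp_neg_mul _ (gRate_pos n)]
    have := (gRate_pos n).ne'
    field_simp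
    ring

lemma summable_one_div_add_two_pow (k : ℕ) :
    Summable fun n : ℕ => 1 / ((n : ℝ) + 2) ^ (k + 2) := by
  have := (summable_nat_add_iff 2).2 (Real.summable_one_div_nat_pow.2 (by omega : 1 < k + 2))
  simpa using this

lemma riemannZeta_eq_one_add_tsum (k : ℕ) :
    riemannZeta ((k + 2 : ℕ) : ℂ) =
      ((1 + ∑' n : ℕ, 1 / ((n : ℝ) + 2) ^ (k + 2) : ℝ) : ℂ) := by
  rw [zeta_nat_eq_tsum_of_gt_one (by omega)]
  have hs := Real.summable_one_div_nat_pow.2 (by omega : 1 < k + 2)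
  have h2 := hs.sum_add_tsum_nat_add 2
  have : (∑' n : ℕ, 1 / (n : ℂ) ^ (k + 2)) = ((∑' n : ℕ, 1 / (n : ℝ) ^ (k + 2) : ℝ) : ℂ) := by
    push_cast; rfl
  rw [this, ← h2]
  simp [Finset.sum_range_succ]

lemma integrableOn_pow_mul_exp_neg_mul_one_div (k : ℕ) :
    IntegrableOn (fun t : ℝ => t ^ (k + 1) * Real.exp (-t) * (1 / (Real.exp t - 1))) (Ioi 0) := by
  refine (integrableOn_pow_mul_exp_neg_mul k one_pos).mono'
    (Measurable.aestronglyMeasurable (by fun_prop)) ?_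
  filter_upwards [ae_restrict_mem measurableSet_Ioi] with t ht
  have ht : 0 < t := ht
  have h1 : t ≤ Real.exp t - 1 := by linarith [Real.add_one_le_exp t]
  have h2 : 0 < Real.exp t - 1 := ht.trans_le h1
  rw [Real.norm_of_nonneg (by positivity), one_mul]
  calc t ^ (k + 1) * Real.exp (-t) * (1 / (Real.exp t - 1))
      ≤ t ^ (k + 1) * Real.exp (-t) * (1 / t) := by gcongr
    _ = _ := by field_simp; ring

lemma integral_pow_mul_exp_neg_mul_one_div (k : ℕ) :
    ∫ t in Ioi (0 : ℝ), t ^ (k + 1) * Real.exp (-t) * (1 / (Real.exp t - 1)) =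
      (k + 1).factorial * ∑' n : ℕ, 1 / ((n : ℝ) + 2) ^ (k + 2) := by
  have hpos (n : ℕ) : (0 : ℝ) < n + 2 := by positivity
  have hval (n : ℕ) := integral_pow_mul_exp_neg_mul (k + 1) (hpos n)
  have hsum := hasSum_integral_Ioi
    (F := fun n t => t ^ (k + 1) * Real.exp (-(((n : ℝ) + 2) * t)))
    (f := fun t => t ^ (k + 1) * Real.exp (-t) * (1 / (Real.exp t - 1)))
    (fun n => integrableOn_pow_mul_exp_neg_mul (k + 1) (hpos n))
    ((summable_one_div_add_two_pow k).mul_left ((k + 1).factorial : ℝ))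
    (fun n => by
      rw [setIntegral_congr_fun (g := fun t => t ^ (k + 1) * Real.exp (-(((n : ℝ) + 2) * t)))
        measurableSet_Ioi, hval]
      · exact (mul_one_div _ _).ge
      · intro t ht
        have ht : 0 < t := ht
        exact Real.norm_of_nonneg (by positivity))
    (fun t ht => by
      have hlt : Real.exp (-t) < 1 := by simpa using ht
      convert! (hasSum_geometric_of_lt_one (Real.exp_pos _).le hlt).mul_left
        (t ^ (k + 1) * Real.exp (-t) * Real.exp (-t)) using 1
      · ext n
        rw [← Real.exp_nat_mul, mul_assoc, mul_assoc, ← Real.exp_add, ← Real.exp_add]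
        ring_nf
      · have h1 : Real.exp t - 1 ≠ 0 := by linarith [Real.add_one_lt_exp ht.ne']
        have h2 := Real.exp_pos t
        rw [Real.exp_neg]
        field_simp)
  rw [← hsum.tsum_eq, ← tsum_mul_left]
  simp_rw [hval, mul_one_div]

lemma hasSum_two_mul_gRateIntegral (k : ℕ) :
    HasSum (fun n => 2 * gRateIntegral (k + 1) n)
      ((k + 1).factorial * (∑' n : ℕ, 1 / ((n : ℝ) + 2) ^ (k + 2)) - k.factorial +
        (k + 1).factorial / 2) := by
  have hsum := hasSum_integral_Ioi
    (fun n => (integrableOn_gRate_integrand (k + 1) n).const_mul 2)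
    (summable_one_div_gRate_sq.mul_left (2 * (k + 1 + 1).factorial : ℝ))
    (fun n => by
      simp_rw [norm_mul (2 : ℝ), integral_const_mul, mul_assoc (2 : ℝ)]
      rw [Real.norm_two]
      gcongr
      exact integral_norm_gRate_integrand_le (k + 1) n)
    (fun t ht => by
      convert! (hasSum_two_mul_div_add_gRate_sq ht).mul_left (t ^ (k + 1) * Real.exp (-t)) using 1
      ext n
      ring)
  simp_rw [integral_const_mul] at hsum
  convert! hsum using 1
  have i1 := integrableOn_pow_mul_exp_neg_mul_one_div k
  have i2 := integrableOn_pow_mul_exp_neg_mul k one_pos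
  have i3 := (integrableOn_pow_mul_exp_neg_mul (k + 1) one_pos).div_const 2
  rw [setIntegral_congr_fun (g := fun t => t ^ (k + 1) * Real.exp (-t) * (1 / (Real.exp t - 1)) -
      t ^ k * Real.exp (-(1 * t)) + t ^ (k + 1) * Real.exp (-(1 * t)) / 2) measurableSet_Ioi,
    integral_add _ i3, integral_sub i1 i2, integral_pow_mul_exp_neg_mul_one_div,
    integral_div, integral_pow_mul_exp_neg_mul _ one_pos, integral_pow_mul_exp_neg_mul _ one_pos]
  · simp
  · exact i1.sub i2
  · intro t ht
    have ht : 0 < t := ht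
    simp only [one_mul]
    field_simp
    ring

theorem riemannZeta_nat_eq_integral (s : ℕ) (hs : 2 ≤ s) :
    riemannZeta s =
      ((1 / 2 + 1 / ((s : ℝ) - 1) +
        2 * (-1) ^ (s - 1) / ((s - 1).factorial : ℝ) *
          ∫ x in Ioi (0 : ℝ), x ^ s / (1 + x ^ 2) * iteratedDeriv (s - 1) g x : ℝ) : ℂ) ∧
    riemannZeta s =
      ((1 / 2 + 1 / ((s : ℝ) - 1) +
        2 / ((s - 1).factorial : ℝ) *
          ∫ x in Ioi (0 : ℝ), g x * iteratedDeriv (s - 1) (h s) x : ℝ) : ℂ) := by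
  obtain ⟨k, rfl⟩ := Nat.exists_eq_add_of_le' hs
  have hB := hasSum_gRateIntegral_integral_g_mul (k + 1)
  have hA := (hasSum_gRateIntegral_integral_h_mul (k + 1)).unique (hB.mul_left _)
  have hT := (hB.mul_left 2).unique (hasSum_two_mul_gRateIntegral k)
  rw [riemannZeta_eq_one_add_tsum, Complex.ofReal_inj, Complex.ofReal_inj,
    show k + 2 - 1 = k + 1 by omega]
  change _ = 1 / 2 + _ + _ * (∫ x in Ioi (0 : ℝ), h (k + 2) x * _) ∧ _
  have hk : (k : ℝ) + 1 ≠ 0 := by positivity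
  have hfac : (((k + 1).factorial : ℕ) : ℝ) = (k + 1) * k.factorial := by
    rw [Nat.factorial_succ]; push_cast; ring
  have hf0 : (k.factorial : ℝ) ≠ 0 := by positivity
  have hmain : 1 + ∑' n : ℕ, 1 / ((n : ℝ) + 2) ^ (k + 2) =
      1 / 2 + 1 / (((k + 2 : ℕ) : ℝ) - 1) + 2 / ((k + 1).factorial : ℝ) *
        ∫ x in Ioi (0 : ℝ), g x * iteratedDeriv (k + 1) (h (k + 2)) x := by
    rw [div_mul_eq_mul_div, hT, hfac, show ((k + 2 : ℕ) : ℝ) - 1 = k + 1 by push_cast; ring]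
    field_simp
    ring
  refine ⟨?_, hmain⟩
  rw [hmain, hA, ← mul_assoc]
  congr 2
  rw [div_mul_eq_mul_div, mul_assoc, ← mul_pow]
  simp
end

section
/- For every natural number k, the k-th Bernoulli number satisfies B_k = (π/2) ∫_{−∞}^{∞} (−1/2 + it)^k / cosh²(πt) dt, i.e. Bernoulli numbers are the moments of the positive weight (π/2)·sech²(πt) carried along the vertical line −1/2 + iℝ. -/
open Real Complex MeasureTheory

lemma exists_one_add_abs_pow_le_cosh_sq (m : ℕ) :
    ∃ C : ℝ, 0 < C ∧ ∀ t : ℝ, (1 + |t|) ^ m ≤ C * Real.cosh (π * t) ^ 2 := by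
  refine ⟨4 * m.factorial * Real.exp 1, by positivity, fun t => ?_⟩
  have hfac : (1 + |t|) ^ m ≤ m.factorial * Real.exp (1 + |t|) := by
    have := Real.pow_div_factorial_le_exp (1 + |t|) (by positivity) m
    rwa [div_le_iff₀' (by positivity)] at this
  have hcosh : Real.exp |t| ≤ 4 * Real.cosh (π * t) ^ 2 := by
    have hge : Real.exp |π * t| ≤ 2 * Real.cosh (π * t) := by
      rw [← Real.cosh_abs, Real.cosh_eq]
      linarith [Real.exp_pos (-|π * t|)]
    have hone : 1 ≤ Real.exp |π * t| := Real.one_le_exp (abs_nonneg _)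
    have hle : Real.exp |t| ≤ Real.exp |π * t| := by
      rw [Real.exp_le_exp, abs_mul, abs_of_pos Real.pi_pos]
      nlinarith [Real.pi_gt_three, abs_nonneg t]
    nlinarith
  calc (1 + |t|) ^ m ≤ m.factorial * (Real.exp 1 * Real.exp |t|) := by rwa [← Real.exp_add]
    _ ≤ m.factorial * (Real.exp 1 * (4 * Real.cosh (π * t) ^ 2)) := by gcongr
    _ = _ := by ring

lemma integrable_pow_div_cosh_sq (a : ℂ) (k : ℕ) :
    Integrable fun t : ℝ =>
      (a + t * Complex.I) ^ k / ((Real.cosh (π * t) : ℝ) : ℂ) ^ 2 := by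
  obtain ⟨C, hC, hbound⟩ := exists_one_add_abs_pow_le_cosh_sq (k + 2)
  have hne (t : ℝ) : ((Real.cosh (π * t) : ℝ) : ℂ) ^ 2 ≠ 0 :=
    pow_ne_zero _ (by exact_mod_cast (Real.cosh_pos _).ne')
  refine (integrable_inv_one_add_sq.const_mul ((‖a‖ + 1) ^ k * C)).mono'
    (Continuous.aestronglyMeasurable ?_) (.of_forall fun t => ?_)
  · exact Continuous.div (by fun_prop) (by fun_prop) hne
  have hnum : ‖a + t * Complex.I‖ ≤ (‖a‖ + 1) * (1 + |t|) := by
    have := norm_add_le a (t * Complex.I)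
    simp only [norm_mul, Complex.norm_real, Complex.norm_I, mul_one, Real.norm_eq_abs] at this
    nlinarith [norm_nonneg a, abs_nonneg t, mul_nonneg (norm_nonneg a) (abs_nonneg t)]
  have hsq : 1 + t ^ 2 ≤ (1 + |t|) ^ 2 := by nlinarith [abs_nonneg t, sq_abs t]
  have hcosh := Real.cosh_pos (π * t)
  rw [norm_div, norm_pow, norm_pow, Complex.norm_real, Real.norm_eq_abs, sq_abs,
    ← div_eq_mul_inv, div_le_div_iff₀ (by positivity) (by positivity)]
  calc ‖a + t * Complex.I‖ ^ k * (1 + t ^ 2)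
      ≤ ((‖a‖ + 1) * (1 + |t|)) ^ k * (1 + |t|) ^ 2 := by gcongr
    _ = (‖a‖ + 1) ^ k * (1 + |t|) ^ (k + 2) := by rw [mul_pow, pow_add, mul_assoc]
    _ ≤ (‖a‖ + 1) ^ k * (C * Real.cosh (π * t) ^ 2) := by gcongr; exact hbound t
    _ = _ := by ring

lemma integral_one_div_cosh_sq :
    ∫ t : ℝ, (1 : ℂ) / ((Real.cosh (π * t) : ℝ) : ℂ) ^ 2 = 2 / π := by
  have hint : Integrable fun t : ℝ => 1 / Real.cosh (π * t) ^ 2 := by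
    refine (integrable_pow_div_cosh_sq 0 0).norm.congr (.of_forall fun t => ?_)
    simp only [pow_zero, norm_div, norm_one, norm_pow, Complex.norm_real, Real.norm_eq_abs, sq_abs]
  have hderiv (t : ℝ) : HasDerivAt (fun t => -(2 / π) / (Real.exp (2 * π * t) + 1))
      (1 / Real.cosh (π * t) ^ 2) t := by
    have hexp : HasDerivAt (fun t => Real.exp (2 * π * t) + 1)
        (Real.exp (2 * π * t) * (2 * π)) t := by
      simpa using (((hasDerivAt_id t).const_mul (2 * π)).exp).add_const 1
    refine ((hasDerivAt_const t (-(2 / π))).div hexp (by positivity)).congr_deriv ?_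
    have hsq : Real.exp (2 * π * t) = Real.exp (π * t) ^ 2 := by
      rw [← Real.exp_nat_mul]; congr 1; push_cast; ring
    have hpi := Real.pi_pos
    rw [Real.cosh_eq, Real.exp_neg, hsq]
    field_simp
    ring
  have hlin : Filter.Tendsto (fun t : ℝ => 2 * π * t) Filter.atBot Filter.atBot :=
    Filter.tendsto_id.const_mul_atBot (by positivity)
  have hlin' : Filter.Tendsto (fun t : ℝ => 2 * π * t) Filter.atTop Filter.atTop :=
    Filter.tendsto_id.const_mul_atTop (by positivity)
  have hbot : Filter.Tendsto (fun t => -(2 / π) / (Real.exp (2 * π * t) + 1))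
      Filter.atBot (nhds (-(2 / π) / (0 + 1))) :=
    tendsto_const_nhds.div ((Real.tendsto_exp_atBot.comp hlin).add_const 1) (by norm_num)
  have htop : Filter.Tendsto (fun t => -(2 / π) / (Real.exp (2 * π * t) + 1))
      Filter.atTop (nhds 0) :=
    tendsto_const_nhds.div_atTop
      (Filter.tendsto_atTop_add_const_right _ 1 (Real.tendsto_exp_atTop.comp hlin'))
  have h := integral_of_hasDerivAt_of_tendsto hderiv hint hbot htop
  calc ∫ t : ℝ, (1 : ℂ) / ((Real.cosh (π * t) : ℝ) : ℂ) ^ 2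
      = ∫ t : ℝ, ((1 / Real.cosh (π * t) ^ 2 : ℝ) : ℂ) := by push_cast; rfl
    _ = 2 / π := by rw [integral_complex_ofReal, h]; push_cast; ring

lemma abs_sinh_im_le_norm_sin (z : ℂ) : |Real.sinh z.im| ≤ ‖Complex.sin z‖ := by
  have h := abs_norm_sub_norm_le (Complex.exp (-z * Complex.I)) (Complex.exp (z * Complex.I))
  rw [Complex.norm_exp, Complex.norm_exp] at h
  simp only [Complex.mul_re, Complex.neg_re, Complex.neg_im, Complex.I_re, Complex.I_im, mul_zero,
    mul_one, zero_sub, neg_neg] at h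
  rw [Complex.sin, Real.sinh_eq, norm_div, norm_mul, Complex.norm_I, mul_one, abs_div]
  simpa using div_le_div_of_nonneg_right h two_pos.le

lemma sin_pi_mul_ne_zero_of_abs_re_le_half {z : ℂ} (hre : |z.re| ≤ 1 / 2) (hz : z ≠ 0) :
    Complex.sin (π * z) ≠ 0 := by
  rw [Ne, Complex.sin_eq_zero_iff]
  rintro ⟨n, hn⟩
  have hzn : z = n := by
    have hpi : (π : ℂ) ≠ 0 := by exact_mod_cast Real.pi_ne_zero
    exact mul_left_cancel₀ hpi (hn.trans (mul_comm _ _))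
  subst hzn
  have hlt : |(n : ℝ)| < 1 := by
    rw [Complex.intCast_re] at hre; linarith
  have hn0 : n = 0 := Int.abs_lt_one_iff.mp (by exact_mod_cast hlt)
  exact hz (by simp [hn0])

/-- The entire function `sin (π z) / z`. -/
noncomputable def sinPiDiv : ℂ → ℂ := dslope (fun z => Complex.sin (π * z)) 0

lemma differentiable_sinPiDiv : Differentiable ℂ sinPiDiv := by
  rw [← differentiableOn_univ, sinPiDiv, Complex.differentiableOn_dslope Filter.univ_mem]
  fun_prop

lemma mul_sinPiDiv (z : ℂ) : z * sinPiDiv z = Complex.sin (π * z) := by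
  simpa [sinPiDiv] using sub_smul_dslope (fun z => Complex.sin (π * z)) 0 z

lemma sinPiDiv_ne_zero {z : ℂ} (hre : |z.re| ≤ 1 / 2) : sinPiDiv z ≠ 0 := by
  rcases eq_or_ne z 0 with rfl | hz
  · have h : HasDerivAt (fun z : ℂ => Complex.sin (π * z)) π 0 := by
      simpa using ((hasDerivAt_id (0 : ℂ)).const_mul (π : ℂ)).csin
    rw [sinPiDiv, dslope_same, h.deriv]
    exact_mod_cast Real.pi_ne_zero
  · intro h
    exact sin_pi_mul_ne_zero_of_abs_re_le_half hre hz (by rw [← mul_sinPiDiv, h, mul_zero])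

lemma pow_div_sinPiDiv_sq (m : ℕ) {z : ℂ} (hz : z ≠ 0) :
    z ^ m / sinPiDiv z ^ 2 = z ^ (m + 2) / Complex.sin (π * z) ^ 2 := by
  rw [← mul_sinPiDiv, pow_add, mul_pow, mul_comm (z ^ m),
    mul_div_mul_left _ _ (pow_ne_zero 2 hz)]

lemma exists_norm_pow_div_sinPiDiv_sq_le (m : ℕ) :
    ∃ C : ℝ, ∀ z : ℂ, |z.re| ≤ 1 / 2 → 1 ≤ |z.im| →
      ‖z ^ m / sinPiDiv z ^ 2‖ ≤ C / |z.im| := by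
  obtain ⟨C, hC, hbound⟩ := exists_one_add_abs_pow_le_cosh_sq (m + 3)
  refine ⟨2 * C, fun z hre him => ?_⟩
  have hz : z ≠ 0 := by rintro rfl; norm_num at him
  have hnorm : ‖z‖ ≤ 1 + |z.im| := (Complex.norm_le_abs_re_add_abs_im z).trans (by linarith)
  have hsinh_one : 1 ≤ |Real.sinh (π * z.im)| := by
    have harg : 1 ≤ |π * z.im| := by
      rw [abs_mul, abs_of_pos Real.pi_pos]; nlinarith [Real.pi_gt_three]
    rw [Real.abs_sinh]
    exact harg.trans (Real.self_le_sinh_iff.mpr (abs_nonneg _))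
  have hsin : |Real.sinh (π * z.im)| ≤ ‖Complex.sin (π * z)‖ := by
    simpa using abs_sinh_im_le_norm_sin (π * z)
  have hcosh : Real.cosh (π * z.im) ^ 2 ≤ 2 * ‖Complex.sin (π * z)‖ ^ 2 := by
    have := Real.cosh_sq (π * z.im)
    nlinarith [sq_abs (Real.sinh (π * z.im))]
  have hsin_pos : 0 < ‖Complex.sin (π * z)‖ := by linarith
  rw [pow_div_sinPiDiv_sq m hz, norm_div, norm_pow, norm_pow,
    div_le_div_iff₀ (by positivity) (by linarith)]
  calc ‖z‖ ^ (m + 2) * |z.im| ≤ (1 + |z.im|) ^ (m + 2) * (1 + |z.im|) := by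
        gcongr; linarith
    _ = (1 + |z.im|) ^ (m + 3) := by ring
    _ ≤ C * (2 * ‖Complex.sin (π * z)‖ ^ 2) := (hbound _).trans (by gcongr)
    _ = _ := by ring

lemma tendsto_integral_pow_div_sinPiDiv_sq_horizontal (m : ℕ) {l : Filter ℝ}
    (hl : Filter.Tendsto (fun T : ℝ => |T|) l Filter.atTop) :
    Filter.Tendsto (fun T : ℝ => ∫ x in (-(1 / 2) : ℝ)..(1 / 2),
      ((x : ℂ) + T * Complex.I) ^ m / sinPiDiv (x + T * Complex.I) ^ 2) l (nhds 0) := by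
  obtain ⟨C, hC⟩ := exists_norm_pow_div_sinPiDiv_sq_le m
  refine squeeze_zero_norm' ?_ (tendsto_const_nhds.div_atTop hl : Filter.Tendsto
    (fun T : ℝ => C / |T|) l (nhds 0))
  filter_upwards [hl.eventually_ge_atTop 1] with T hT
  have h := intervalIntegral.norm_integral_le_of_norm_le_const (a := (-(1 / 2) : ℝ)) (b := 1 / 2)
    (C := C / |T|)
    (f := fun x : ℝ => ((x : ℂ) + T * Complex.I) ^ m / sinPiDiv (x + T * Complex.I) ^ 2)
    fun x hx => by
      rw [Set.uIoc_of_le (by norm_num)] at hx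
      have hre : |((x : ℂ) + T * Complex.I).re| ≤ 1 / 2 := by
        have hx' := abs_le.mpr ⟨hx.1.le, hx.2⟩
        simpa using hx'
      simpa using hC (x + T * Complex.I) hre (by simpa using hT)
  norm_num at h ⊢
  exact h

lemma integral_half_add_pow_eq_neg_half_add_pow (m : ℕ) :
    ∫ t : ℝ, (1 / 2 + t * Complex.I) ^ (m + 2) / ((Real.cosh (π * t) : ℝ) : ℂ) ^ 2 =
      ∫ t : ℝ, (-(1 / 2) + t * Complex.I) ^ (m + 2) / ((Real.cosh (π * t) : ℝ) : ℂ) ^ 2 := by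
  have hline (a : ℂ) (ha : a = 1 / 2 ∨ a = -(1 / 2)) (t : ℝ) :
      (a + t * Complex.I) ^ m / sinPiDiv (a + t * Complex.I) ^ 2 =
        (a + t * Complex.I) ^ (m + 2) / ((Real.cosh (π * t) : ℝ) : ℂ) ^ 2 := by
    have hz : a + t * Complex.I ≠ 0 := by
      intro h
      have := congrArg Complex.re h
      rcases ha with rfl | rfl <;> norm_num at this
    rw [pow_div_sinPiDiv_sq m hz]
    congr 1
    have hcos : Complex.cos (π * t * Complex.I) = ((Real.cosh (π * t) : ℝ) : ℂ) := by
      rw [Complex.cos_mul_I]; push_cast; rfl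
    rcases ha with rfl | rfl
    · rw [show (π : ℂ) * (1 / 2 + t * Complex.I) = π * t * Complex.I + π / 2 by ring,
        Complex.sin_add_pi_div_two, hcos]
    · rw [show (π : ℂ) * (-(1 / 2) + t * Complex.I) = π * t * Complex.I - π / 2 by ring,
        Complex.sin_sub_pi_div_two, hcos, neg_sq]
  have hdiff (T : ℝ) : DifferentiableOn ℂ (fun z => z ^ m / sinPiDiv z ^ 2)
      (Set.uIcc (-(1 / 2)) (1 / 2) ×ℂ Set.uIcc (-T) T) := by
    refine DifferentiableOn.div (differentiable_pow m).differentiableOn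
      (differentiable_sinPiDiv.differentiableOn.pow 2) fun z hz => pow_ne_zero 2 ?_
    have hre := hz.1
    rw [Set.mem_preimage, Set.uIcc_of_le (by norm_num)] at hre
    exact sinPiDiv_ne_zero (abs_le.mpr hre)
  have hrect (T : ℝ) := Complex.integral_boundary_rect_eq_zero_of_differentiableOn
    (fun z => z ^ m / sinPiDiv z ^ 2) ⟨-(1 / 2), -T⟩ ⟨1 / 2, T⟩ (hdiff T)
  have hcast₁ : ((-(1 / 2) : ℝ) : ℂ) = -(1 / 2) := by norm_num
  have hcast₂ : ((1 / 2 : ℝ) : ℂ) = 1 / 2 := by norm_num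
  simp only [hcast₁, hcast₂, hline _ (Or.inl rfl), hline _ (Or.inr rfl)] at hrect
  have hvert (a : ℂ) := intervalIntegral_tendsto_integral (integrable_pow_div_cosh_sq a (m + 2))
    Filter.tendsto_neg_atTop_atBot Filter.tendsto_id
  have hbot := (tendsto_integral_pow_div_sinPiDiv_sq_horizontal m
    Filter.tendsto_abs_atBot_atTop).comp Filter.tendsto_neg_atTop_atBot
  have htop := tendsto_integral_pow_div_sinPiDiv_sq_horizontal m Filter.tendsto_abs_atTop_atTop
  have hlim := ((hbot.sub htop).add ((hvert (1 / 2)).const_smul Complex.I)).sub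
    ((hvert (-(1 / 2))).const_smul Complex.I)
  have hzero := tendsto_nhds_unique hlim (tendsto_const_nhds.congr fun T => (hrect T).symm)
  rw [sub_zero, zero_add, ← smul_sub, smul_eq_zero_iff_right Complex.I_ne_zero] at hzero
  exact sub_eq_zero.mp hzero

lemma sum_choose_mul_integral_eq_zero {n : ℕ} (hn : n ≠ 1) :
    ∑ j ∈ Finset.range n, (n.choose j : ℂ) *
      ∫ t : ℝ, (-(1 / 2) + t * Complex.I) ^ j / ((Real.cosh (π * t) : ℝ) : ℂ) ^ 2 = 0 := by
  obtain rfl | ⟨m, rfl⟩ : n = 0 ∨ ∃ m, n = m + 2 := by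
    rcases n with _ | _ | m
    · simp
    · simp at hn
    · exact Or.inr ⟨m, rfl⟩
  · simp
  have hint (j : ℕ) := integrable_pow_div_cosh_sq (-(1 / 2)) j
  have hexpand (t : ℝ) :
      (1 / 2 + t * Complex.I) ^ (m + 2) / ((Real.cosh (π * t) : ℝ) : ℂ) ^ 2 =
        ∑ j ∈ Finset.range (m + 3), ((m + 2).choose j : ℂ) *
          ((-(1 / 2) + t * Complex.I) ^ j / ((Real.cosh (π * t) : ℝ) : ℂ) ^ 2) := by
    rw [show (1 / 2 + t * Complex.I : ℂ) = (-(1 / 2) + t * Complex.I) + 1 by ring, add_pow,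
      Finset.sum_div]
    refine Finset.sum_congr rfl fun j _ => ?_
    rw [one_pow]; ring
  have h := integral_half_add_pow_eq_neg_half_add_pow m
  simp_rw [hexpand] at h
  rw [integral_finsetSum _ fun j _ => (hint j).const_mul _, Finset.sum_range_succ] at h
  simpa [integral_const_mul] using h

theorem bernoulli_eq_moment_sech_sq (k : ℕ) :
    (bernoulli k : ℂ) =
      (π / 2) * ∫ t : ℝ, (-(1 / 2) + t * Complex.I) ^ k / ((Real.cosh (π * t) : ℝ) : ℂ) ^ 2 := by
  induction k using Nat.strong_induction_on with
  | _ k ih =>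
    rcases Nat.eq_zero_or_pos k with rfl | hk
    · have hpi : (π : ℂ) ≠ 0 := by exact_mod_cast Real.pi_ne_zero
      simp only [pow_zero, integral_one_div_cosh_sq, bernoulli_zero]
      field_simp
      simp
    · have hB : ∑ j ∈ Finset.range (k + 1), ((k + 1).choose j : ℂ) * (bernoulli j : ℂ) = 0 := by
        have h := sum_bernoulli (k + 1)
        rw [if_neg (by omega)] at h
        exact_mod_cast h
      have hM := congrArg ((π / 2 : ℂ) * ·)
        (sum_choose_mul_integral_eq_zero (n := k + 1) (by omega))
      simp only [Finset.mul_sum, mul_zero, mul_left_comm (π / 2 : ℂ)] at hM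
      rw [← hM, Finset.sum_range_succ, Finset.sum_range_succ,
        Finset.sum_congr rfl fun j hj => by rw [ih j (Finset.mem_range.mp hj)]] at hB
      refine mul_left_cancel₀ ?_ (add_left_cancel hB)
      exact_mod_cast (Nat.choose_pos k.le_succ).ne'
end
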